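/- Let m, n be positive integers, τ ∈ ℍ, and z ∈ ℂ such that 1 − ζ q^{k−1/2} ≠ 0 and 1 − ζ^{−1} q^{k−1/2} ≠ 0 for all integers k ≥ 1 (equivalently, z + τ/2 ∉ ℤτ + ℤ). Then the convergent infinite product identity ∏_{k=1}^∞ (1 + ζ q^{k−1/2})^m (1 + ζ^{−1} q^{k−1/2})^m (1 − ζ q^{k−1/2})^{−n} (1 − ζ^{−1} q^{k−1/2})^{−n} = (−1)^m i^{−n} e^{πi(m−n)z} q^{(m−n)/6} η(τ)^{n−m} · ϑ(z + τ/2 + 1/2; τ)^m · ϑ(z + τ/2; τ)^{−n} holds. -/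

import Mathlib

open Real

/-- The Jacobi theta function
`ϑ(z;τ) := ∑_{ν ∈ 1/2 + ℤ} e^{πiν²τ + 2πiν(z+1/2)}`, parametrized by `ν = n + 1/2, n ∈ ℤ`. -/
noncomputable def jacobiThetaKW (z τ : ℂ) : ℂ :=
  ∑' n : ℤ, Complex.exp (π * Complex.I * ((n : ℂ) + 1 / 2) ^ 2 * τ +
      2 * π * Complex.I * ((n : ℂ) + 1 / 2) * (z + 1 / 2))

/-- The Dedekind eta function `η(τ) := q^{1/24} ∏_{k=1}^∞ (1 − q^k)`, `q = e^{2πiτ}`. -/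
noncomputable def dedekindEta (τ : ℂ) : ℂ :=
  Complex.exp (π * Complex.I * τ / 12) *
    ∏' k : ℕ, (1 - Complex.exp (2 * π * Complex.I * τ * ((k : ℂ) + 1)))


noncomputable def kwQ (q : ℂ) (N : ℕ) : ℂ := ∏ k ∈ Finset.range N, (1 - q ^ (k + 1))

noncomputable def kwG (q : ℂ) (N k : ℕ) : ℂ :=
  if k ≤ N then kwQ q N / (kwQ q k * kwQ q (N - k)) else 0

lemma kwQ_succ (q : ℂ) (N : ℕ) : kwQ q (N + 1) = kwQ q N * (1 - q ^ (N + 1)) := by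
  simp [kwQ, Finset.prod_range_succ]

lemma kwQ_ne {q : ℂ} (h : ∀ k : ℕ, 1 - q ^ (k + 1) ≠ 0) (N : ℕ) : kwQ q N ≠ 0 :=
  Finset.prod_ne_zero_iff.mpr fun k _ => h k

lemma kwG_zero {q : ℂ} (h : ∀ k : ℕ, 1 - q ^ (k + 1) ≠ 0) (N : ℕ) : kwG q N 0 = 1 := by
  have := kwQ_ne h N
  simp only [kwG, Nat.zero_le, if_true, Nat.sub_zero]
  have h0 : kwQ q 0 = 1 := by simp [kwQ]
  rw [h0, one_mul, div_self this]

lemma kwG_pascal {q : ℂ} (h : ∀ k : ℕ, 1 - q ^ (k + 1) ≠ 0) (N k : ℕ) (hk : k ≤ N) :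
    kwG q (N + 1) (k + 1) = kwG q N (k + 1) + q ^ (N - k) * kwG q N k := by
  have h1 := kwQ_ne h
  obtain ⟨d, rfl⟩ := Nat.exists_eq_add_of_le hk
  rcases d with _ | d
  · simp only [kwG]
    have a := h1 k
    have b := h1 (k+1)
    simp [kwQ] at *
    rw [div_self a, div_self b]
  · have e1 : k + (d + 1) + 1 - (k + 1) = d + 1 := by omega
    have e2 : k + (d + 1) - (k + 1) = d := by omega
    have e3 : k + (d + 1) - k = d + 1 := by omega
    have l1 : k + 1 ≤ k + (d + 1) + 1 := by omega
    have l2 : k + 1 ≤ k + (d + 1) := by omega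
    have l3 : k ≤ k + (d + 1) := by omega
    simp only [kwG, e1, e2, e3, if_pos l1, if_pos l2, if_pos l3]
    rw [kwQ_succ q (k + (d+1)), kwQ_succ q k, kwQ_succ q d]
    have := h1 k
    have := h1 d
    have := h k
    have := h d
    field_simp
    ring

lemma kw_qbinom {q : ℂ} (h : ∀ k : ℕ, 1 - q ^ (k + 1) ≠ 0) (y : ℂ) (N : ℕ) :
    ∏ k ∈ Finset.range N, (1 + y * q ^ k) =
      ∑ k ∈ Finset.range (N + 1), kwG q N k * q ^ (k.choose 2) * y ^ k := by
  induction N with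
  | zero => simp [kwG_zero h]
  | succ N ih =>
    rw [Finset.prod_range_succ, ih, Finset.sum_range_succ' _ (N + 1)]
    have e : ∑ k ∈ Finset.range (N + 1), kwG q N k * q ^ (k.choose 2) * y ^ k
        = ∑ k ∈ Finset.range (N + 1), kwG q N (k+1) * q ^ ((k+1).choose 2) * y ^ (k+1) + 1 := by
      have : kwG q N (N + 1) = 0 := by simp [kwG]
      have e2 := Finset.sum_range_succ (fun k => kwG q N k * q ^ (k.choose 2) * y ^ k) (N + 1)
      rw [Finset.sum_range_succ' _ (N + 1)] at e2
      simp [this, kwG_zero h] at e2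
      exact e2.symm
    rw [mul_add, mul_one]
    nth_rewrite 1 [e]
    rw [Finset.sum_mul]
    have : ∀ k ∈ Finset.range (N+1), kwG q (N+1) (k + 1) * q ^ ((k + 1).choose 2) * y ^ (k + 1)
       = kwG q N (k+1) * q ^ ((k+1).choose 2) * y ^ (k+1)
         + kwG q N k * q ^ (k.choose 2) * y ^ k * (y * q ^ N) := by
      intro k hk
      have hk' : k ≤ N := by simpa [Nat.lt_succ_iff] using hk
      rw [kwG_pascal h N k hk']
      have c : (k+1).choose 2 = k + k.choose 2 := by
        rw [Nat.choose_succ_succ' k 1]; simp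
      have e : q ^ N = q ^ (N - k) * q ^ k := by rw [← pow_add]; congr 1; omega
      rw [c, e]; ring
    rw [Finset.sum_congr rfl this, Finset.sum_add_distrib]
    simp [kwG_zero h]
    ring

lemma kw_aux_prod {p x : ℂ} (hp : p ≠ 0) (hx : x ≠ 0) (n : ℕ) :
    ∏ k ∈ Finset.range (n + n), (1 + (x * p ^ (1 - 2 * (n : ℤ))) * (p ^ 2) ^ k) =
     x ^ (n : ℤ) * p ^ (-(n : ℤ) ^ 2) *
      ∏ i ∈ Finset.range n, ((1 + x * p ^ (2 * i + 1)) * (1 + x⁻¹ * p ^ (2 * i + 1))) := by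
  rw [Finset.prod_range_add, ← Finset.prod_range_reflect]
  have e0 : ∀ n : ℕ, x ^ (n : ℤ) * p ^ (-(n : ℤ) ^ 2) =
      ∏ i ∈ Finset.range n, x * p ^ (-(2 * (i : ℤ) + 1)) := by
    intro n
    induction n with
    | zero => simp
    | succ n ih =>
      rw [Finset.prod_range_succ, ← ih]
      have : (-((n + 1 : ℕ) : ℤ) ^ 2) = -(n : ℤ) ^ 2 + (-(2 * (n : ℤ) + 1)) := by push_cast; ring
      rw [this, zpow_add₀ hp]
      push_cast
      rw [zpow_add₀ hx]; simp; ring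
  rw [e0, ← Finset.prod_mul_distrib, ← Finset.prod_mul_distrib]
  refine Finset.prod_congr rfl fun i hi => ?_
  have hi : i < n := by simpa using hi
  have a1 : p ^ (1 - 2 * (n : ℤ)) * (p ^ 2) ^ (n - 1 - i) = p ^ (-(2 * (i : ℤ) + 1)) := by
    rw [← pow_mul, ← zpow_natCast, ← zpow_add₀ hp]; congr 1
    omega
  have a2 : p ^ (1 - 2 * (n : ℤ)) * (p ^ 2) ^ (n + i) = p ^ (2 * i + 1) := by
    rw [← pow_mul, ← zpow_natCast, ← zpow_natCast, ← zpow_add₀ hp]; congr 1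
    push_cast; ring
  have a3 : p ^ (-(2 * (i : ℤ) + 1)) = (p ^ (2 * i + 1))⁻¹ := by
    rw [zpow_neg]; norm_cast
  rw [mul_assoc x, mul_assoc x, a1, a2, a3]
  have : p ^ (2 * i + 1) ≠ 0 := pow_ne_zero _ hp
  field_simp
  ring

lemma kw_finite {p x : ℂ} (hp : p ≠ 0) (hx : x ≠ 0) (h : ∀ k : ℕ, 1 - (p ^ 2) ^ (k + 1) ≠ 0)
    (n : ℕ) :
    ∏ i ∈ Finset.range n, ((1 + x * p ^ (2 * i + 1)) * (1 + x⁻¹ * p ^ (2 * i + 1))) =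
    ∑ k ∈ Finset.range (n + n + 1), kwG (p ^ 2) (n + n) k *
      (p ^ (((k : ℤ) - n) ^ 2) * x ^ ((k : ℤ) - n)) := by
  have h1 := kw_aux_prod hp hx n
  rw [kw_qbinom h] at h1
  have hn : x ^ (n : ℤ) * p ^ (-(n : ℤ) ^ 2) ≠ 0 :=
    mul_ne_zero (zpow_ne_zero _ hx) (zpow_ne_zero _ hp)
  apply mul_left_cancel₀ hn
  rw [← h1, Finset.mul_sum]
  refine Finset.sum_congr rfl fun k _ => ?_
  have c : (p ^ 2) ^ (k.choose 2) = p ^ ((k : ℤ) ^ 2 - k) := by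
    rw [← pow_mul, ← zpow_natCast]; congr 1
    have := Nat.choose_two_right k
    have h2 : 2 * (k * (k - 1) / 2) = k * (k - 1) :=
      Nat.mul_div_cancel' (Nat.even_mul_pred_self k).two_dvd
    rw [this, h2]
    rcases k with _ | k
    · simp
    · rw [Nat.add_sub_cancel]; push_cast; ring
  rw [c, mul_pow, ← zpow_natCast x k, ← zpow_natCast (p ^ _) k, ← zpow_mul]
  have e1 : x ^ (k : ℤ) = x ^ (n : ℤ) * x ^ ((k : ℤ) - n) := by
    rw [← zpow_add₀ hx]; congr 1; ring
  have e2 : p ^ ((k : ℤ) ^ 2 - k) * p ^ ((1 - 2 * (n : ℤ)) * k) =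
      p ^ (-(n : ℤ) ^ 2) * p ^ (((k : ℤ) - n) ^ 2) := by
    rw [← zpow_add₀ hp, ← zpow_add₀ hp]; congr 1; ring
  rw [e1]
  linear_combination (kwG (p ^ 2) (n + n) k * x ^ (n : ℤ) * x ^ ((k : ℤ) - n)) * e2

open Filter Topology in
lemma kwG_lim {q : ℂ} (hq : ‖q‖ < 1) :
    (∃ C : ℝ, ∀ N k, ‖kwG q N k‖ ≤ C) ∧ (∏' k : ℕ, (1 - q ^ (k + 1))) ≠ 0 ∧
    (∀ k : ℕ, 1 - q ^ (k + 1) ≠ 0) ∧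
    ∀ j : ℤ, Tendsto (fun n : ℕ => if 0 ≤ (n : ℤ) + j then kwG q (n + n) ((n : ℤ) + j).toNat else 0)
      atTop (𝓝 (∏' k : ℕ, (1 - q ^ (k + 1)))⁻¹) := by
  have h : ∀ k : ℕ, 1 - q ^ (k + 1) ≠ 0 := by
    intro k hk
    have h1 : ‖q ^ (k + 1)‖ < 1 := by
      rw [norm_pow]; exact pow_lt_one₀ (norm_nonneg _) hq (by omega)
    rw [← sub_eq_zero.mp hk] at h1
    simp at h1
  have hs : Summable fun k : ℕ => ‖q‖ ^ (k + 1) :=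
    (summable_nat_add_iff 1).mpr (summable_geometric_of_lt_one (norm_nonneg _) hq)
  have hL : (∏' k : ℕ, (1 - q ^ (k + 1))) ≠ 0 := by
    have := tprod_one_add_ne_zero_of_summable (f := fun k : ℕ => -q ^ (k + 1))
      (by intro i; simpa [sub_eq_add_neg] using h i) (by simpa using hs)
    simpa [sub_eq_add_neg] using this
  set L := ∏' k : ℕ, (1 - q ^ (k + 1)) with hLdef
  have hT : Tendsto (kwQ q) atTop (𝓝 L) :=
    (ModularForm.multipliable_one_sub_pow hq).tendsto_prod_tprod_nat
  have hTi : Tendsto (fun n => (kwQ q n)⁻¹) atTop (𝓝 L⁻¹) := hT.inv₀ hL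
  obtain ⟨A, hA⟩ := (Metric.isBounded_range_of_tendsto _ hT).exists_norm_le
  obtain ⟨B, hB⟩ := (Metric.isBounded_range_of_tendsto _ hTi).exists_norm_le
  have hA' : ∀ n, ‖kwQ q n‖ ≤ A := fun n => hA _ ⟨n, rfl⟩
  have hB' : ∀ n, ‖(kwQ q n)⁻¹‖ ≤ B := fun n => hB _ ⟨n, rfl⟩
  have hA0 : 0 ≤ A := (norm_nonneg _).trans (hA' 0)
  have hB0 : 0 ≤ B := (norm_nonneg _).trans (hB' 0)
  refine ⟨⟨A * (B * B), ?_⟩, hL, h, ?_⟩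
  · intro N k
    unfold kwG
    split_ifs
    · rw [div_eq_mul_inv, mul_inv, norm_mul, norm_mul]
      gcongr
      · exact hA' _
      · exact hB' _
      · exact hB' _
    · simp; positivity
  · intro j
    have t1 : Tendsto (fun n : ℕ => n + n) atTop atTop :=
      tendsto_atTop_mono (fun n => Nat.le_add_left n n) tendsto_id
    have t2 : ∀ j : ℤ, Tendsto (fun n : ℕ => ((n : ℤ) + j).toNat) atTop atTop := by
      intro j
      refine tendsto_atTop.mpr fun b => ?_
      filter_upwards [eventually_ge_atTop (b + j.natAbs)] with n hn
      omega
    have t := (hT.comp t1).mul ((hTi.comp (t2 j)).mul (hTi.comp (t2 (-j))))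
    have e : L * (L⁻¹ * L⁻¹) = L⁻¹ := by field_simp
    rw [e] at t
    refine t.congr' ?_
    filter_upwards [eventually_ge_atTop j.natAbs] with n hn
    have c1 : 0 ≤ (n : ℤ) + j := by omega
    have c2 : ((n : ℤ) + j).toNat ≤ n + n := by omega
    have c3 : n + n - ((n : ℤ) + j).toNat = ((n : ℤ) + -j).toNat := by omega
    simp only [Function.comp, if_pos c1, kwG, if_pos c2, c3]
    rw [div_eq_mul_inv, mul_inv]

lemma kw_norm {τ : ℂ} (hτ : 0 < τ.im) : ‖Complex.exp (π * Complex.I * τ)‖ < 1 := by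
  rw [Complex.norm_exp]
  simp
  positivity

lemma kw_norm_sq {τ : ℂ} (hτ : 0 < τ.im) : ‖Complex.exp (π * Complex.I * τ) ^ 2‖ < 1 := by
  rw [norm_pow]; exact pow_lt_one₀ (norm_nonneg _) (kw_norm hτ) (by omega)

lemma kw_summ {p : ℂ} (hp : ‖p‖ < 1) (x : ℂ) : Summable fun i : ℕ => ‖x * p ^ (2 * i + 1)‖ := by
  have : Summable fun i : ℕ => ‖x‖ * (‖p‖ * (‖p‖ ^ 2) ^ i) :=
    ((summable_geometric_of_lt_one (by positivity)
      (pow_lt_one₀ (norm_nonneg _) hp (by omega))).mul_left _).mul_left _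
  refine this.congr fun i => ?_
  rw [norm_mul, norm_pow]; ring

open Filter Topology in
lemma kw_jtp {τ : ℂ} (hτ : 0 < τ.im) (z : ℂ) {p x : ℂ} (hp : p = Complex.exp (π * Complex.I * τ))
    (hx : x = Complex.exp (2 * π * Complex.I * z)) :
    HasProd (fun i : ℕ => (1 + x * p ^ (2 * i + 1)) * (1 + x⁻¹ * p ^ (2 * i + 1)))
      ((∏' k : ℕ, (1 - (p ^ 2) ^ (k + 1)))⁻¹ * jacobiTheta₂ z τ) := by
  have hp1 : ‖p‖ < 1 := hp ▸ kw_norm hτ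
  have hq1 : ‖p ^ 2‖ < 1 := hp ▸ kw_norm_sq hτ
  have hp0 : p ≠ 0 := hp ▸ Complex.exp_ne_zero _
  have hx0 : x ≠ 0 := hx ▸ Complex.exp_ne_zero _
  obtain ⟨⟨C, hC⟩, hL, h, hlim⟩ := kwG_lim hq1
  have hC0 : 0 ≤ C := (norm_nonneg _).trans (hC 0 0)
  have hmul : Multipliable (fun i : ℕ => (1 + x * p ^ (2 * i + 1)) * (1 + x⁻¹ * p ^ (2 * i + 1))) :=
    (multipliable_one_add_of_summable (kw_summ hp1 x)).mul
      (multipliable_one_add_of_summable (kw_summ hp1 x⁻¹))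
  have hterm : ∀ j : ℤ, jacobiTheta₂_term j z τ = p ^ (j ^ 2) * x ^ j := by
    intro j
    rw [jacobiTheta₂_term, hp, hx, ← Complex.exp_int_mul, ← Complex.exp_int_mul, ← Complex.exp_add]
    congr 1; push_cast; ring
  have hsum := (summable_jacobiTheta₂_term_iff z τ).mpr hτ
  have key := tendsto_tsum_of_dominated_convergence (𝓕 := atTop)
    (f := fun (n : ℕ) (j : ℤ) => (if 0 ≤ (n : ℤ) + j then kwG (p ^ 2) (n + n) ((n : ℤ) + j).toNat
      else 0) * jacobiTheta₂_term j z τ)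
    (g := fun j => (∏' k : ℕ, (1 - (p ^ 2) ^ (k + 1)))⁻¹ * jacobiTheta₂_term j z τ)
    (bound := fun j => C * ‖jacobiTheta₂_term j z τ‖)
    (hsum.norm.mul_left C) (fun j => (hlim j).mul_const _)
    (Eventually.of_forall fun n j => by
      rw [norm_mul]
      gcongr
      split_ifs
      · exact hC _ _
      · simpa using hC0)
  rw [tsum_mul_left] at key
  have hfin : ∀ n : ℕ, ∑' j : ℤ, (if 0 ≤ (n : ℤ) + j then
      kwG (p ^ 2) (n + n) ((n : ℤ) + j).toNat else 0) * jacobiTheta₂_term j z τ =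
      ∏ i ∈ Finset.range n, ((1 + x * p ^ (2 * i + 1)) * (1 + x⁻¹ * p ^ (2 * i + 1))) := by
    intro n
    rw [kw_finite hp0 hx0 h]
    have inj : Function.Injective (fun k : ℕ => (k : ℤ) - n) := by
      intro a b hab; simpa using hab
    rw [tsum_eq_sum (s := (Finset.range (n + n + 1)).image (fun k : ℕ => (k : ℤ) - n)),
      Finset.sum_image (fun a _ b _ hab => inj hab)]
    · refine Finset.sum_congr rfl fun k _ => ?_
      have c1 : 0 ≤ (n : ℤ) + ((k : ℤ) - n) := by omega
      have c2 : ((n : ℤ) + ((k : ℤ) - n)).toNat = k := by omega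
      rw [if_pos c1, c2, hterm]
    · intro j hj
      split_ifs with hc
      · have : ¬ ((n : ℤ) + j).toNat ≤ n + n := by
          intro hle
          apply hj
          refine Finset.mem_image.mpr ⟨((n : ℤ) + j).toNat, ?_, ?_⟩
          · rw [Finset.mem_range]; omega
          · omega
        simp [kwG, this]
      · simp
  simp only [hfin] at key
  have := tendsto_nhds_unique hmul.tendsto_prod_tprod_nat key
  have h2 := hmul.hasProd
  rw [this] at h2
  exact h2

lemma kw_theta (w τ : ℂ) : jacobiTheta₂ (w + 1 / 2) τ =
    Complex.I * Complex.exp (π * Complex.I * τ / 4) * Complex.exp (π * Complex.I * w) *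
      jacobiThetaKW (w + τ / 2) τ := by
  rw [jacobiTheta₂, jacobiThetaKW, ← (Equiv.addRight (1 : ℤ)).tsum_eq, ← tsum_mul_left]
  refine tsum_congr fun n => ?_
  have hI : Complex.I = Complex.exp (π / 2 * Complex.I) := Complex.exp_pi_div_two_mul_I.symm
  nth_rewrite 1 [hI]
  rw [jacobiTheta₂_term, ← Complex.exp_add, ← Complex.exp_add, ← Complex.exp_add]
  congr 1
  simp only [Equiv.coe_addRight]
  push_cast
  ring

lemma kw_eta (τ : ℂ) : dedekindEta τ = Complex.exp (π * Complex.I * τ / 12) *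
    ∏' k : ℕ, (1 - (Complex.exp (π * Complex.I * τ) ^ 2) ^ (k + 1)) := by
  rw [dedekindEta]
  congr 1
  refine tprod_congr fun k => ?_
  rw [← pow_mul, ← Complex.exp_nat_mul]
  congr 2
  push_cast; ring

lemma kw_half (τ : ℂ) (k : ℕ) : Complex.exp (2 * π * Complex.I * τ * ((k : ℂ) + 1 / 2)) =
    Complex.exp (π * Complex.I * τ) ^ (2 * k + 1) := by
  rw [← Complex.exp_nat_mul]
  congr 1
  push_cast; ring

lemma kw_exp_half (w : ℂ) : Complex.exp (2 * π * Complex.I * (w + 1 / 2)) =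
    -Complex.exp (2 * π * Complex.I * w) := by
  have : 2 * π * Complex.I * (w + 1 / 2) = 2 * π * Complex.I * w + π * Complex.I := by ring
  rw [this, Complex.exp_add, Complex.exp_pi_mul_I]; ring

lemma kw_eta_ne {τ : ℂ} (hτ : 0 < τ.im) : dedekindEta τ ≠ 0 := by
  rw [kw_eta]
  exact mul_ne_zero (Complex.exp_ne_zero _) (kwG_lim (kw_norm_sq hτ)).2.1

lemma kw_key {τ : ℂ} (hτ : 0 < τ.im) (w : ℂ) :
    HasProd (fun k : ℕ =>
      (1 - Complex.exp (2 * π * Complex.I * w) *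
          Complex.exp (2 * π * Complex.I * τ * ((k : ℂ) + 1 / 2))) *
      (1 - (Complex.exp (2 * π * Complex.I * w))⁻¹ *
          Complex.exp (2 * π * Complex.I * τ * ((k : ℂ) + 1 / 2))))
      (Complex.I * Complex.exp (π * Complex.I * τ / 3) * Complex.exp (π * Complex.I * w) *
        jacobiThetaKW (w + τ / 2) τ * (dedekindEta τ)⁻¹) := by
  have h := kw_jtp hτ (w + 1 / 2) rfl rfl
  have hL := (kwG_lim (kw_norm_sq hτ)).2.1
  rw [kw_theta, kw_exp_half] at h
  simp only [kw_half]
  convert h using 1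
  · funext k
    rw [inv_neg]; ring
  · rw [kw_eta, mul_inv, ← Complex.exp_neg]
    have : Complex.exp (π * Complex.I * τ / 4) =
        Complex.exp (π * Complex.I * τ / 3) * Complex.exp (-(π * Complex.I * τ / 12)) := by
      rw [← Complex.exp_add]; congr 1; ring
    rw [this]; ring

lemma kw_ne {τ : ℂ} (hτ : 0 < τ.im) (x : ℂ)
    (h : ∀ k : ℕ, 1 - x * Complex.exp (2 * π * Complex.I * τ * ((k : ℂ) + 1 / 2)) ≠ 0) :
    ∃ a ≠ 0, HasProd
      (fun k : ℕ => 1 - x * Complex.exp (2 * π * Complex.I * τ * ((k : ℂ) + 1 / 2))) a := by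
  have hs : Summable fun k : ℕ =>
      ‖-(x * Complex.exp (2 * π * Complex.I * τ * ((k : ℂ) + 1 / 2)))‖ := by
    simp only [norm_neg, kw_half]
    exact kw_summ (kw_norm hτ) x
  have h1 := tprod_one_add_ne_zero_of_summable
    (f := fun k : ℕ => -(x * Complex.exp (2 * π * Complex.I * τ * ((k : ℂ) + 1 / 2))))
    (by intro k; simpa only [← sub_eq_add_neg] using h k) hs
  have h2 := (multipliable_one_add_of_summable hs).hasProd
  simp only [← sub_eq_add_neg] at h1 h2
  exact ⟨_, h1, h2⟩


/-- Let `m, n` be positive integers, `τ ∈ ℍ`, and `z ∈ ℂ` such that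
`1 − ζ q^{k−1/2} ≠ 0` and `1 − ζ^{−1} q^{k−1/2} ≠ 0` for all integers `k ≥ 1`. Then
`∏_{k=1}^∞ (1 + ζ q^{k−1/2})^m (1 + ζ^{−1} q^{k−1/2})^m (1 − ζ q^{k−1/2})^{−n}
  (1 − ζ^{−1} q^{k−1/2})^{−n}
  = (−1)^m i^{−n} e^{πi(m−n)z} q^{(m−n)/6} η(τ)^{n−m} ϑ(z + τ/2 + 1/2; τ)^m ϑ(z + τ/2; τ)^{−n}`,
the infinite product being convergent.  Here `q := e^{2πiτ}`, `ζ := e^{2πiz}`, the factor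
`q^{k−1/2}` is written as `e^{2πiτ(k−1/2)}` and `q^{(m−n)/6}` as `e^{πiτ(m−n)/3}`. -/
theorem stmt_17 (m n : ℕ) (hm : 0 < m) (hn : 0 < n) (τ : ℂ) (hτ : 0 < τ.im) (z : ℂ)
    (hpole : ∀ k : ℕ,
      1 - Complex.exp (2 * π * Complex.I * z) *
            Complex.exp (2 * π * Complex.I * τ * ((k : ℂ) + 1 / 2)) ≠ 0 ∧
      1 - (Complex.exp (2 * π * Complex.I * z))⁻¹ *
            Complex.exp (2 * π * Complex.I * τ * ((k : ℂ) + 1 / 2)) ≠ 0) :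
    Multipliable (fun k : ℕ =>
      (1 + Complex.exp (2 * π * Complex.I * z) *
          Complex.exp (2 * π * Complex.I * τ * ((k : ℂ) + 1 / 2))) ^ m *
      (1 + (Complex.exp (2 * π * Complex.I * z))⁻¹ *
          Complex.exp (2 * π * Complex.I * τ * ((k : ℂ) + 1 / 2))) ^ m *
      (1 - Complex.exp (2 * π * Complex.I * z) *
          Complex.exp (2 * π * Complex.I * τ * ((k : ℂ) + 1 / 2))) ^ (-(n : ℤ)) *
      (1 - (Complex.exp (2 * π * Complex.I * z))⁻¹ *
          Complex.exp (2 * π * Complex.I * τ * ((k : ℂ) + 1 / 2))) ^ (-(n : ℤ))) ∧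
    (∏' k : ℕ,
      (1 + Complex.exp (2 * π * Complex.I * z) *
          Complex.exp (2 * π * Complex.I * τ * ((k : ℂ) + 1 / 2))) ^ m *
      (1 + (Complex.exp (2 * π * Complex.I * z))⁻¹ *
          Complex.exp (2 * π * Complex.I * τ * ((k : ℂ) + 1 / 2))) ^ m *
      (1 - Complex.exp (2 * π * Complex.I * z) *
          Complex.exp (2 * π * Complex.I * τ * ((k : ℂ) + 1 / 2))) ^ (-(n : ℤ)) *
      (1 - (Complex.exp (2 * π * Complex.I * z))⁻¹ *
          Complex.exp (2 * π * Complex.I * τ * ((k : ℂ) + 1 / 2))) ^ (-(n : ℤ)))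
      = (-1) ^ m * Complex.I ^ (-(n : ℤ)) * Complex.exp (π * Complex.I * ((m : ℂ) - n) * z) *
          Complex.exp (π * Complex.I * τ * ((m : ℂ) - n) / 3) *
          dedekindEta τ ^ ((n : ℤ) - m) *
          jacobiThetaKW (z + τ / 2 + 1 / 2) τ ^ m *
          jacobiThetaKW (z + τ / 2) τ ^ (-(n : ℤ)) := by
  have hb := kw_key hτ z
  have ha := kw_key hτ (z + 1 / 2)
  obtain ⟨c, hc0, hc⟩ := kw_ne hτ _ (fun k => (hpole k).1)
  obtain ⟨d, hd0, hd⟩ := kw_ne hτ _ (fun k => (hpole k).2)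
  have hη := kw_eta_ne hτ
  have hb0 := mul_ne_zero hc0 hd0
  rw [(hc.mul hd).unique hb] at hb0
  have hP := (ha.pow m).mul ((hb.pow n).inv₀ (pow_ne_zero n hb0))
  have hE : Complex.exp (π * Complex.I * (z + 1 / 2)) =
      Complex.I * Complex.exp (π * Complex.I * z) := by
    have : π * Complex.I * (z + 1 / 2) = π / 2 * Complex.I + π * Complex.I * z := by ring
    rw [this, Complex.exp_add, Complex.exp_pi_div_two_mul_I]
  have hz : z + 1 / 2 + τ / 2 = z + τ / 2 + 1 / 2 := by ring
  have hz1 : Complex.exp (π * Complex.I * ((m : ℂ) - n) * z) =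
      Complex.exp (π * Complex.I * z) ^ m * (Complex.exp (π * Complex.I * z) ^ n)⁻¹ := by
    rw [← Complex.exp_nat_mul, ← Complex.exp_nat_mul, ← Complex.exp_neg, ← Complex.exp_add]
    congr 1; ring
  have hz2 : Complex.exp (π * Complex.I * τ * ((m : ℂ) - n) / 3) =
      Complex.exp (π * Complex.I * τ / 3) ^ m * (Complex.exp (π * Complex.I * τ / 3) ^ n)⁻¹ := by
    rw [← Complex.exp_nat_mul, ← Complex.exp_nat_mul, ← Complex.exp_neg, ← Complex.exp_add]
    congr 1; ring
  rw [hz1, hz2, zpow_sub₀ hη]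
  simp only [zpow_neg, zpow_natCast]
  rw [hE, hz, kw_exp_half] at hP
  refine (fun H => ⟨HasProd.multipliable H, HasProd.tprod_eq H⟩) (?_ : HasProd _ _)
  convert hP using 1
  · funext k
    rw [inv_neg, mul_pow, mul_pow, mul_inv]; ring
  · have hI : ∀ T : ℂ, Complex.I * Complex.exp (π * Complex.I * τ / 3) *
        (Complex.I * Complex.exp (π * Complex.I * z)) * T * (dedekindEta τ)⁻¹ =
        (-1) * Complex.exp (π * Complex.I * τ / 3) * Complex.exp (π * Complex.I * z) * T *
          (dedekindEta τ)⁻¹ := by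
      intro T
      linear_combination (Complex.exp (π * Complex.I * τ / 3) * Complex.exp (π * Complex.I * z) * T *
          (dedekindEta τ)⁻¹) * Complex.I_mul_I
    rw [hI]
    simp only [mul_pow, mul_inv, inv_pow, inv_inv]
    ring
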